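/- Let G be a finite connected simple graph. Then G has a disconnected cut if and only if the complement of G has a 2K2-partition. -/

import Mathlib

namespace Paper

/-- Adjacency in the reflexive 4-cycle `H` between *distinct* vertices
(`h_i h_{i+1}` cycle edges), vertices indexed by `ZMod 4`. -/
def C4adj (x y : ZMod 4) : Prop := y = x + 1 ∨ x = y + 1

/-- A homomorphism from a simple graph `G` to the reflexive 4-cycle `H`:
every edge is mapped to a self-loop or to a cycle edge of `H`. -/
def IsHomC4 {V : Type} (G : SimpleGraph V) (f : V → ZMod 4) : Prop :=
  ∀ u v : V, G.Adj u v → f u = f v ∨ C4adj (f u) (f v)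

/-- A compaction from a simple graph `G` to the reflexive 4-cycle `H`:
a homomorphism such that every cycle edge of `H` is the image of an edge. -/
def IsCompactionC4 {V : Type} (G : SimpleGraph V) (f : V → ZMod 4) : Prop :=
  IsHomC4 G f ∧ ∀ x y : ZMod 4, C4adj x y → ∃ u v : V, G.Adj u v ∧ f u = x ∧ f v = y

/-- `G` has a disconnected cut: a set `U` of vertices such that both the
subgraph induced by `U` and the one induced by its complement have at least
two connected components (i.e. contain an unreachable pair of vertices). -/
def HasDisconnectedCut {V : Type} (G : SimpleGraph V) : Prop :=
  ∃ U : Set V,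
    (∃ x y : ↥U, ¬ (G.induce U).Reachable x y) ∧
    (∃ x y : ↥(Uᶜ), ¬ (G.induce (Uᶜ)).Reachable x y)

/-- A `2S2`-partition of `G`, encoded by the map sending each vertex to the
index of its block: all four blocks are nonempty, there are no edges between
blocks 0 and 2, and none between blocks 1 and 3. -/
def TwoS2Partition {V : Type} (G : SimpleGraph V) : Prop :=
  ∃ f : V → Fin 4, Function.Surjective f ∧
    (∀ u v : V, f u = 0 → f v = 2 → ¬ G.Adj u v) ∧
    (∀ u v : V, f u = 1 → f v = 3 → ¬ G.Adj u v)

/-- A `2K2`-partition of `G`, encoded by the map sending each vertex to the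
index of its block: all four blocks are nonempty, every vertex of block 0 is
adjacent to every vertex of block 2, and likewise for blocks 1 and 3. -/
def TwoK2Partition {V : Type} (G : SimpleGraph V) : Prop :=
  ∃ f : V → Fin 4, Function.Surjective f ∧
    (∀ u v : V, f u = 0 → f v = 2 → G.Adj u v) ∧
    (∀ u v : V, f u = 1 → f v = 3 → G.Adj u v)

/-- `G` is contractible to `H`: the vertices of `G` can be partitioned into
nonempty connected witness sets `P x`, one for each vertex `x` of `H`, such
that two distinct witness sets are joined by an edge of `G` exactly when the
corresponding vertices are adjacent in `H`. -/
def ContractsTo {V W : Type} (G : SimpleGraph V) (H : SimpleGraph W) : Prop :=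
  ∃ P : W → Set V,
    (∀ x : W, (G.induce (P x)).Connected) ∧
    (∀ v : V, ∃! x : W, v ∈ P x) ∧
    (∀ x y : W, x ≠ y →
      ((∃ u ∈ P x, ∃ v ∈ P y, G.Adj u v) ↔ H.Adj x y))

/-- An induced subgraph has an unreachable pair of vertices iff its vertex set splits into two
nonempty parts with no edges between them. -/
theorem exists_not_reachable_induce_iff {V : Type} (G : SimpleGraph V) (S : Set V) :
    (∃ x y : ↥S, ¬ (G.induce S).Reachable x y) ↔
      ∃ A ⊆ S, A.Nonempty ∧ (S \ A).Nonempty ∧ ∀ u ∈ A, ∀ v ∈ S \ A, ¬ G.Adj u v := by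
  constructor
  · rintro ⟨x, y, hxy⟩
    refine ⟨{v | ∃ h : v ∈ S, (G.induce S).Reachable x ⟨v, h⟩}, fun v hv => hv.1,
      ⟨x, x.2, .refl _⟩, ⟨y, y.2, fun h => hxy h.2⟩, ?_⟩
    rintro u ⟨hu, hxu⟩ v ⟨hv, hxv⟩ huv
    have hadj : (G.induce S).Adj ⟨u, hu⟩ ⟨v, hv⟩ := huv
    exact hxv ⟨hv, hxu.trans hadj.reachable⟩
  · rintro ⟨A, hAS, ⟨x, hx⟩, ⟨y, hyS, hyA⟩, hA⟩
    refine ⟨⟨x, hAS hx⟩, ⟨y, hyS⟩, ?_⟩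
    rintro ⟨p⟩
    obtain ⟨d, -, hd, hd'⟩ := p.exists_boundary_dart {v | (v : V) ∈ A} hx hyA
    exact hA _ hd _ ⟨d.snd.2, hd'⟩ d.adj

/-- A finite connected simple graph has a disconnected cut iff its complement
has a `2K2`-partition. -/
theorem stmt15 {V : Type} [Fintype V] (G : SimpleGraph V) (hc : G.Connected) :
    HasDisconnectedCut G ↔ TwoK2Partition Gᶜ := by
  classical
  simp only [HasDisconnectedCut, exists_not_reachable_induce_iff]
  constructor
  · rintro ⟨U, ⟨A, hAU, ⟨a, ha⟩, ⟨c, hcU, hcA⟩, hA⟩, ⟨B, hBU, ⟨b, hb⟩, ⟨d, hdU, hdB⟩, hB⟩⟩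
    let f : V → Fin 4 := fun v =>
      if v ∈ U then (if v ∈ A then 0 else 2) else (if v ∈ B then 1 else 3)
    have f0 : ∀ v, f v = 0 → v ∈ A := by intro v; simp only [f]; split_ifs <;> simp_all
    have f1 : ∀ v, f v = 1 → v ∈ B := by intro v; simp only [f]; split_ifs <;> simp_all
    have f2 : ∀ v, f v = 2 → v ∈ U \ A := by intro v; simp only [f]; split_ifs <;> simp_all
    have f3 : ∀ v, f v = 3 → v ∈ Uᶜ \ B := by intro v; simp only [f]; split_ifs <;> simp_all
    refine ⟨f, ?_, fun u v hu hv => ?_, fun u v hu hv => ?_⟩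
    · have haU := hAU ha
      have hbU : b ∉ U := hBU hb
      have hdU' : d ∉ U := hdU
      intro i
      fin_cases i
      · exact ⟨a, by simp [f, haU, ha]⟩
      · exact ⟨b, by simp [f, hbU, hb]⟩
      · exact ⟨c, by simp [f, hcU, hcA]⟩
      · exact ⟨d, by simp [f, hdU', hdB]⟩
    · refine (SimpleGraph.compl_adj _ _ _).2 ⟨?_, hA u (f0 u hu) v (f2 v hv)⟩
      rintro rfl
      simp [hu] at hv
    · refine (SimpleGraph.compl_adj _ _ _).2 ⟨?_, hB u (f1 u hu) v (f3 v hv)⟩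
      rintro rfl
      simp [hu] at hv
  · rintro ⟨f, hf, h02, h13⟩
    obtain ⟨a, ha⟩ := hf 0
    obtain ⟨b, hb⟩ := hf 1
    obtain ⟨c, hc⟩ := hf 2
    obtain ⟨d, hd⟩ := hf 3
    have key : ∀ i : Fin 4, ¬ (i = 0 ∨ i = 2) → i ≠ 1 → i = 3 := by decide
    refine ⟨{v | f v = 0 ∨ f v = 2},
      ⟨{v | f v = 0}, fun v hv => Or.inl hv, ⟨a, ha⟩, ⟨c, Or.inr hc, by simp [hc]⟩, ?_⟩,
      ⟨{v | f v = 1}, ?_, ⟨b, hb⟩, ⟨d, by simp [hd], by simp [hd]⟩, ?_⟩⟩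
    · rintro u hu v ⟨hv, hv'⟩
      exact ((SimpleGraph.compl_adj _ _ _).1 (h02 u v hu (hv.resolve_left hv'))).2
    · intro v hv
      have hv' : f v = 1 := hv
      simp [hv']
    · rintro u hu v ⟨hv, hv'⟩
      exact ((SimpleGraph.compl_adj _ _ _).1 (h13 u v hu (key _ hv hv'))).2

end Paper
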